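/- The functions λ'(x) = (√3/(4π)) · (1−x²)^{−1/3} · [ (1−x)^{−1/3} + (1+x)^{−1/3} ] on (−1,1) and ν'(x) = (√3/(2π)) · (x²−1)^{−1/3} · [ (|x|−1)^{−1/3} − (|x|+1)^{−1/3} ] on {x ∈ ℝ : |x| > 1} are nonnegative probability densities: λ' ≥ 0 with ∫_{−1}^{1} λ'(x) dx = 1, and ν' ≥ 0 with ∫_{|x|>1} ν'(x) dx = 1. -/

import Mathlib

open MeasureTheory

/-- The density `λ'(x) = (√3/(4π)) (1−x²)^{−1/3} [(1−x)^{−1/3} + (1+x)^{−1/3}]` on `(−1,1)`. -/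
noncomputable def lambdaDensity (x : ℝ) : ℝ :=
  Real.sqrt 3 / (4 * Real.pi) * (1 - x ^ 2) ^ (-(1 / 3) : ℝ) *
    ((1 - x) ^ (-(1 / 3) : ℝ) + (1 + x) ^ (-(1 / 3) : ℝ))

/-- The density `ν'(x) = (√3/(2π)) (x²−1)^{−1/3} [(|x|−1)^{−1/3} − (|x|+1)^{−1/3}]` on
`{x : |x| > 1}`. -/
noncomputable def nuDensity (x : ℝ) : ℝ :=
  Real.sqrt 3 / (2 * Real.pi) * (x ^ 2 - 1) ^ (-(1 / 3) : ℝ) *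
    ((|x| - 1) ^ (-(1 / 3) : ℝ) - (|x| + 1) ^ (-(1 / 3) : ℝ))

lemma cbrt_facts {y : ℝ} (hy : 0 < y) :
    0 < y ^ (1 / 3 : ℝ) ∧ (y ^ (1 / 3 : ℝ)) ^ 3 = y ∧
    y ^ (-(1 / 3) : ℝ) = (y ^ (1 / 3 : ℝ))⁻¹ ∧
    HasDerivAt (fun z : ℝ => z ^ (1 / 3 : ℝ)) (1 / (3 * (y ^ (1 / 3 : ℝ)) ^ 2)) y := by
  refine ⟨Real.rpow_pos_of_pos hy _, ?_, Real.rpow_neg hy.le _, ?_⟩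
  · rw [← Real.rpow_natCast, ← Real.rpow_mul hy.le]; norm_num
  · have h := Real.hasDerivAt_rpow_const (x := y) (p := 1 / 3) (Or.inl hy.ne')
    convert h using 1
    have : y ^ ((1 : ℝ) / 3 - 1) = ((y ^ (1 / 3 : ℝ)) ^ 2)⁻¹ := by
      rw [← Real.rpow_natCast, ← Real.rpow_mul hy.le, ← Real.rpow_neg hy.le]; norm_num
    rw [this]; field_simp

lemma lambda_nonneg (x : ℝ) (hx : x ∈ Set.Ioo (-1 : ℝ) 1) : 0 ≤ lambdaDensity x := by
  have h1 : 0 < 1 - x := by linarith [hx.2]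
  have h2 : 0 < 1 + x := by linarith [hx.1]
  have h3 : 0 < 1 - x ^ 2 := by nlinarith
  unfold lambdaDensity
  positivity

lemma nu_nonneg (x : ℝ) (hx : 1 < |x|) : 0 ≤ nuDensity x := by
  have h1 : 0 < |x| - 1 := by linarith
  have h3 : 0 < x ^ 2 - 1 := by rw [← sq_abs]; nlinarith
  have h4 : (|x| + 1) ^ (-(1 / 3) : ℝ) ≤ (|x| - 1) ^ (-(1 / 3) : ℝ) :=
    Real.rpow_le_rpow_of_nonpos h1 (by linarith) (by norm_num)
  unfold nuDensity
  have h5 := sub_nonneg.2 h4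
  positivity

noncomputable def FL (x : ℝ) : ℝ :=
  3 / (2 * Real.pi) * Real.arctan (√3 * (((1 + x) ^ (1 / 3 : ℝ) - (1 - x) ^ (1 / 3 : ℝ)) /
    ((1 + x) ^ (1 / 3 : ℝ) + (1 - x) ^ (1 / 3 : ℝ))))

lemma FL_deriv (x : ℝ) (hx : x ∈ Set.Ioo (-1 : ℝ) 1) : HasDerivAt FL (lambdaDensity x) x := by
  have h1 : 0 < 1 - x := by linarith [hx.2]
  have h2 : 0 < 1 + x := by linarith [hx.1]
  obtain ⟨a0, a3, ai, ad⟩ := cbrt_facts h2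
  obtain ⟨b0, b3, bi, bd⟩ := cbrt_facts h1
  have ad' := ad.comp x ((hasDerivAt_id x).const_add 1)
  have bd' := bd.comp x ((hasDerivAt_id x).const_sub 1)
  have hD := ((((ad'.sub bd').div (ad'.add bd') (by simp; positivity)).const_mul √3).arctan).const_mul
    (3 / (2 * Real.pi))
  have hs : √3 ^ 2 = 3 := Real.sq_sqrt (by norm_num)
  refine hD.congr_deriv ?_
  have hm : (1 - x ^ 2) ^ (-(1 / 3) : ℝ) =
      ((1 + x) ^ (1 / 3 : ℝ))⁻¹ * ((1 - x) ^ (1 / 3 : ℝ))⁻¹ := by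
    rw [← ai, ← bi, ← Real.mul_rpow h2.le h1.le]; congr 1; ring
  simp only [lambdaDensity, hm, ai, bi, Function.comp, Pi.add_apply, Pi.sub_apply, Pi.div_apply]
  have hsum : ((1 + x) ^ (1 / 3 : ℝ)) ^ 3 + ((1 - x) ^ (1 / 3 : ℝ)) ^ 3 = 2 := by
    rw [a3, b3]; ring
  clear hD ad' bd' ad bd
  generalize (1 + x) ^ (1 / 3 : ℝ) = a at *
  generalize (1 - x) ^ (1 / 3 : ℝ) = b at *
  have e1 : 1 + (√3 * ((a - b) / (a + b))) ^ 2 = 4 * (a ^ 2 - a * b + b ^ 2) / (a + b) ^ 2 := by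
    rw [mul_pow, hs]; field_simp; ring
  have e2 : (1 / (3 * a ^ 2) * 1 - 1 / (3 * b ^ 2) * -1) * (a + b) -
      (a - b) * (1 / (3 * a ^ 2) * 1 + 1 / (3 * b ^ 2) * -1) = 4 / (3 * a ^ 2 * b ^ 2) := by
    field_simp; linear_combination 2 * hsum
  have hq : 0 < a ^ 2 - a * b + b ^ 2 := by nlinarith [sq_nonneg (a - b), mul_pos a0 b0]
  have hab : (a + b) * (a ^ 2 - a * b + b ^ 2) = 2 := by linear_combination hsum
  have hq' : a ^ 2 - a * b + b ^ 2 = 2 / (a + b) := by field_simp; linear_combination hab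
  rw [e1, e2, hq']
  have := Real.pi_pos
  field_simp
  ring

lemma FL_cont : ContinuousOn FL (Set.Icc (-1) 1) := by
  unfold FL
  refine continuousOn_const.mul (Real.continuous_arctan.comp_continuousOn
    (continuousOn_const.mul (ContinuousOn.div ?_ ?_ ?_)))
  · exact ((continuousOn_const.add continuousOn_id).rpow_const (fun _ _ => Or.inr (by norm_num))).sub
      ((continuousOn_const.sub continuousOn_id).rpow_const (fun _ _ => Or.inr (by norm_num)))
  · exact ((continuousOn_const.add continuousOn_id).rpow_const (fun _ _ => Or.inr (by norm_num))).add
      ((continuousOn_const.sub continuousOn_id).rpow_const (fun _ _ => Or.inr (by norm_num)))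
  · intro x hx
    rcases lt_or_ge x 0 with h | h
    · have h1 : 0 < (1 - x) ^ (1 / 3 : ℝ) := Real.rpow_pos_of_pos (by linarith) _
      have h2 : 0 ≤ (1 + x) ^ (1 / 3 : ℝ) := Real.rpow_nonneg (by linarith [hx.1]) _
      positivity
    · have h1 : 0 < (1 + x) ^ (1 / 3 : ℝ) := Real.rpow_pos_of_pos (by linarith) _
      have h2 : 0 ≤ (1 - x) ^ (1 / 3 : ℝ) := Real.rpow_nonneg (by linarith [hx.2]) _
      positivity

lemma lambda_int : ∫ x in Set.Ioo (-1 : ℝ) 1, lambdaDensity x = 1 := by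
  rw [← integral_Ioc_eq_integral_Ioo, ← intervalIntegral.integral_of_le (by norm_num),
    intervalIntegral.integral_eq_sub_of_hasDerivAt_of_le (by norm_num) FL_cont FL_deriv]
  · have hz : (0 : ℝ) ^ (1 / 3 : ℝ) = 0 := Real.zero_rpow (by norm_num)
    have h2 : (0 : ℝ) < 2 ^ (1 / 3 : ℝ) := by positivity
    have e1 : FL 1 = 1 / 2 := by
      unfold FL
      rw [sub_self, hz, sub_zero, add_zero, one_add_one_eq_two, div_self h2.ne', mul_one,
        Real.arctan_sqrt_three]
      field_simp
    have e2 : FL (-1) = -(1 / 2) := by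
      unfold FL
      rw [add_neg_cancel, hz, zero_sub, zero_add, sub_neg_eq_add, one_add_one_eq_two, neg_div,
        div_self h2.ne', mul_neg_one, Real.arctan_neg, Real.arctan_sqrt_three]
      field_simp
    rw [e1, e2]; norm_num
  · rw [intervalIntegrable_iff_integrableOn_Ioc_of_le (by norm_num)]
    exact intervalIntegral.integrableOn_deriv_of_nonneg FL_cont FL_deriv lambda_nonneg

noncomputable def GN (x : ℝ) : ℝ :=
  3 / Real.pi * Real.arctan ((2 * ((x - 1) ^ (1 / 3 : ℝ) / (x + 1) ^ (1 / 3 : ℝ)) + 1) / √3)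

lemma GN_deriv (x : ℝ) (hx : x ∈ Set.Ioi (1 : ℝ)) : HasDerivAt GN (nuDensity x) x := by
  have hx' : 1 < x := hx
  have h1 : 0 < x - 1 := by linarith
  have h2 : 0 < x + 1 := by linarith
  obtain ⟨p0, p3, pi, pd⟩ := cbrt_facts h1
  obtain ⟨q0, q3, qi, qd⟩ := cbrt_facts h2
  have pd' := pd.comp x ((hasDerivAt_id x).sub_const 1)
  have qd' := qd.comp x ((hasDerivAt_id x).add_const 1)
  have hD := (((((pd'.div qd' (by simp; positivity)).const_mul 2).add_const 1).div_const
    √3).arctan).const_mul (3 / Real.pi)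
  have hs : √3 ^ 2 = 3 := Real.sq_sqrt (by norm_num)
  refine hD.congr_deriv ?_
  have hm : (x ^ 2 - 1) ^ (-(1 / 3) : ℝ) =
      ((x - 1) ^ (1 / 3 : ℝ))⁻¹ * ((x + 1) ^ (1 / 3 : ℝ))⁻¹ := by
    rw [← pi, ← qi, ← Real.mul_rpow h1.le h2.le]; congr 1; ring
  have habs : |x| = x := abs_of_pos (by linarith)
  simp only [nuDensity, hm, habs, pi, qi, Function.comp, id, Pi.div_apply]
  have hsum : ((x + 1) ^ (1 / 3 : ℝ)) ^ 3 - ((x - 1) ^ (1 / 3 : ℝ)) ^ 3 = 2 := by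
    rw [p3, q3]; ring
  clear hD pd' qd' pd qd
  generalize (x - 1) ^ (1 / 3 : ℝ) = p at *
  generalize (x + 1) ^ (1 / 3 : ℝ) = q at *
  have e1 : 1 + ((2 * (p / q) + 1) / √3) ^ 2 = 4 * (p ^ 2 + p * q + q ^ 2) / (3 * q ^ 2) := by
    rw [div_pow, hs]; field_simp; ring
  have e2 : 1 / (3 * p ^ 2) * 1 * q - p * (1 / (3 * q ^ 2) * 1) = 2 / (3 * p ^ 2 * q ^ 2) := by
    field_simp; linear_combination hsum
  have hq : 0 < p ^ 2 + p * q + q ^ 2 := by positivity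
  have hab : (q - p) * (p ^ 2 + p * q + q ^ 2) = 2 := by linear_combination hsum
  have hqp : p⁻¹ - q⁻¹ = 2 / (p ^ 2 + p * q + q ^ 2) / (p * q) := by
    field_simp; linear_combination hab
  rw [e1, e2, hqp]
  have := Real.pi_pos
  field_simp
  linear_combination (-4) * hs

lemma GN_tendsto : Filter.Tendsto GN Filter.atTop (nhds 1) := by
  have h0 : Filter.Tendsto (fun x : ℝ => 1 - 2 / (x + 1)) Filter.atTop (nhds (1 - 0)) :=
    tendsto_const_nhds.sub (tendsto_const_nhds.div_atTop
      (Filter.tendsto_atTop_add_const_right _ _ Filter.tendsto_id))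
  have h1 := h0.rpow_const (p := 1 / 3) (Or.inr (by norm_num))
  have h2 : Filter.Tendsto (fun x : ℝ => (x - 1) ^ (1 / 3 : ℝ) / (x + 1) ^ (1 / 3 : ℝ))
      Filter.atTop (nhds 1) := by
    rw [sub_zero, Real.one_rpow] at h1
    refine h1.congr' ?_
    filter_upwards [Filter.eventually_gt_atTop 1] with x hx
    rw [← Real.div_rpow (by linarith) (by linarith)]
    congr 1
    have : x + 1 ≠ 0 := by linarith
    field_simp; ring
  have h3 := (((Real.continuous_arctan.tendsto _).comp
    (((h2.const_mul 2).add_const 1).div_const √3)).const_mul (3 / Real.pi))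
  have h4 : 3 / Real.pi * Real.arctan ((2 * 1 + 1) / √3) = 1 := by
    have : (2 * 1 + 1) / √3 = √3 := by norm_num
    rw [this, Real.arctan_sqrt_three]; field_simp
  rw [h4] at h3
  exact h3

lemma GN_cont : ContinuousWithinAt GN (Set.Ici 1) 1 := by
  apply ContinuousAt.continuousWithinAt
  unfold GN
  refine continuousAt_const.mul (Real.continuous_arctan.continuousAt.comp
    ((((continuousAt_const.mul (ContinuousAt.div ?_ ?_ ?_)).add continuousAt_const)).div_const _))
  · exact (continuousAt_id.sub continuousAt_const).rpow_const (Or.inr (by norm_num))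
  · exact (continuousAt_id.add continuousAt_const).rpow_const (Or.inr (by norm_num))
  · positivity

lemma nu_int : ∫ x in {x : ℝ | 1 < |x|}, nuDensity x = 1 := by
  have hI : ∫ x in Set.Ioi (1 : ℝ), nuDensity x = 1 / 2 := by
    rw [integral_Ioi_of_hasDerivAt_of_nonneg GN_cont GN_deriv
      (fun x hx => nu_nonneg x (lt_of_lt_of_le hx (le_abs_self x))) GN_tendsto]
    have hz : (0 : ℝ) ^ (1 / 3 : ℝ) = 0 := Real.zero_rpow (by norm_num)
    have : GN 1 = 1 / 2 := by
      unfold GN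
      rw [sub_self, hz, zero_div, mul_zero, zero_add, one_div √3, Real.arctan_inv_sqrt_three]
      field_simp; norm_num
    rw [this]; norm_num
  have hm : MeasurableSet {x : ℝ | 1 < |x|} := measurableSet_lt measurable_const measurable_abs
  rw [← integral_indicator hm]
  have : ({x : ℝ | 1 < |x|}.indicator nuDensity) =
      fun x => (Set.Ioi (1 : ℝ)).indicator nuDensity |x| := by
    ext x
    simp [Set.indicator, nuDensity]
  rw [this, integral_comp_abs, setIntegral_indicator measurableSet_Ioi,
    Set.inter_eq_self_of_subset_right (Set.Ioi_subset_Ioi zero_le_one), hI]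
  norm_num

/-- `λ'` and `ν'` are nonnegative probability densities on `(−1,1)` and
`{x : |x| > 1}` respectively. -/
theorem stmt_17 :
    (∀ x ∈ Set.Ioo (-1 : ℝ) 1, 0 ≤ lambdaDensity x) ∧
    (∫ x in Set.Ioo (-1 : ℝ) 1, lambdaDensity x = 1) ∧
    (∀ x : ℝ, 1 < |x| → 0 ≤ nuDensity x) ∧
    (∫ x in {x : ℝ | 1 < |x|}, nuDensity x = 1) := by
  exact ⟨lambda_nonneg, lambda_int, nu_nonneg, nu_int⟩
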